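/- arXiv:2402.15169 — 2 statements merged into one kernel-verified Lean document; each statement's English description precedes it below -/
import Mathlib

section
/- Let G be a collaboration instance on n vertices admitting an optimal stable solution, and suppose OPT^IR < OPT^stable. Let PoS = OPT^stable / OPT and set ε = (PoS − 1) / (PoS − 1 + OPT^IR·(n − OPT^IR + 1)/(OPT^IR + 1)) > 0. Then there exists a persuasive identity-independent signaling scheme D whose signal space has at most n + 1 elements and with Cost(D) ≤ OPT^stable − ε·(OPT^stable − OPT^IR); in particular Cost(D) < OPT^stable. -/
open Finset

variable {V : Type*}

/-- A collaboration instance: symmetric matrix with entries in [0,1] and unit diagonal. -/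
def IsCollab [Fintype V] (W : V → V → ℝ) : Prop :=
  (∀ u v, W u v = W v u) ∧ (∀ u v, 0 ≤ W u v ∧ W u v ≤ 1) ∧ (∀ v, W v v = 1)

/-- Unit-weight instance: off-diagonal entries are 0 or 1. -/
def UnitWeight (W : V → V → ℝ) : Prop :=
  ∀ u v : V, u ≠ v → W u v = 0 ∨ W u v = 1

/-- Feasible solution: nonnegative with `W θ ≥ 1` coordinatewise. -/
def Feasible [Fintype V] (W : V → V → ℝ) (θ : V → ℝ) : Prop :=
  (∀ v, 0 ≤ θ v) ∧ ∀ v, 1 ≤ ∑ u, W v u * θ u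

/-- Optimal total workload among feasible solutions. -/
noncomputable def OPT [Fintype V] (W : V → V → ℝ) : ℝ :=
  sInf {c : ℝ | ∃ θ : V → ℝ, Feasible W θ ∧ c = ∑ v, θ v}

/-- Optimal total workload among feasible solutions satisfying IR (`θ ≤ 1`). -/
noncomputable def OPTIR [Fintype V] (W : V → V → ℝ) : ℝ :=
  sInf {c : ℝ | ∃ θ : V → ℝ, Feasible W θ ∧ (∀ v, θ v ≤ 1) ∧ c = ∑ v, θ v}

/-- An identity-independent signaling scheme: a finitely supported probability
distribution over signal functions `s : V → ℝ` whose values lie in a finite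
signal space `sig ⊆ [0,1]`. -/
structure Scheme (V : Type*) [Fintype V] where
  sig : Finset ℝ
  sig_mem : ∀ θ ∈ sig, 0 ≤ θ ∧ θ ≤ 1
  supp : Finset (V → ℝ)
  val_mem : ∀ s ∈ supp, ∀ v : V, s v ∈ sig
  p : (V → ℝ) → ℝ
  p_nonneg : ∀ s ∈ supp, 0 ≤ p s
  p_sum : ∑ s ∈ supp, p s = 1

/-- Expectation of `f` under the scheme's distribution. -/
noncomputable def Scheme.exp [Fintype V] (D : Scheme V) (f : (V → ℝ) → ℝ) : ℝ :=
  ∑ s ∈ D.supp, D.p s * f s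

/-- Expected number of vertices receiving signal `θ`. -/
noncomputable def Scheme.Num [Fintype V] (D : Scheme V) (θ : ℝ) : ℝ :=
  D.exp (fun s => ∑ v, if s v = θ then (1 : ℝ) else 0)

/-- Expected total contribution entering vertices receiving signal `θ`
(the neighborhood sum `∑_{u ∈ N(v)} W v u * s u` equals `∑_{u ≠ v} W v u * s u`). -/
noncomputable def Scheme.Contrib [Fintype V] [DecidableEq V] (D : Scheme V)
    (W : V → V → ℝ) (θ : ℝ) : ℝ :=
  D.exp (fun s => ∑ v, if s v = θ then ∑ u ∈ Finset.univ.erase v, W v u * s u else 0)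

/-- The slack of signal `θ`. -/
noncomputable def Scheme.slack [Fintype V] [DecidableEq V] (D : Scheme V)
    (W : V → V → ℝ) (θ : ℝ) : ℝ :=
  D.Contrib W θ - (1 - θ) * D.Num θ

/-- Persuasiveness: zero slack at positive signals, nonnegative slack at signal 0. -/
def Scheme.Persuasive [Fintype V] [DecidableEq V] (D : Scheme V) (W : V → V → ℝ) : Prop :=
  (∀ θ ∈ D.sig, 0 < θ → D.slack W θ = 0) ∧ ((0 : ℝ) ∈ D.sig → 0 ≤ D.slack W 0)

/-- Cost of a scheme: expected total signal value. -/
noncomputable def Scheme.cost [Fintype V] (D : Scheme V) : ℝ :=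
  D.exp (fun s => ∑ v, s v)

/-- A stable solution: feasible, and each vertex's contribution is the least
nonnegative amount meeting its own feasibility given the others' contributions. -/
def Stable [Fintype V] [DecidableEq V] (W : V → V → ℝ) (θ : V → ℝ) : Prop :=
  Feasible W θ ∧
  ∀ v : V, IsLeast {x : ℝ | 0 ≤ x ∧ 1 ≤ x + ∑ u ∈ Finset.univ.erase v, W v u * θ u} (θ v)

/-- The scheme obtained by pushing a weight function on a finite index type forward along a
family of signal functions. -/
noncomputable def Scheme.ofFamily [Fintype V] [DecidableEq V] {ι : Type*} [Fintype ι]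
    (w : ι → ℝ) (f : ι → V → ℝ) (hw : ∀ i, 0 ≤ w i) (hw1 : ∑ i, w i = 1)
    (sig : Finset ℝ) (hsig : ∀ θ ∈ sig, 0 ≤ θ ∧ θ ≤ 1) (hf : ∀ i v, f i v ∈ sig) :
    Scheme V where
  sig := sig
  sig_mem := hsig
  supp := univ.image f
  val_mem := by
    intro s hs v
    obtain ⟨i, -, rfl⟩ := mem_image.1 hs
    exact hf i v
  p s := ∑ i with f i = s, w i
  p_nonneg _ _ := sum_nonneg fun i _ => hw i
  p_sum := by
    rw [sum_fiberwise_of_maps_to (fun i _ => mem_image_of_mem f (mem_univ i)), hw1]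

theorem Scheme.ofFamily_exp [Fintype V] [DecidableEq V] {ι : Type*} [Fintype ι]
    (w : ι → ℝ) (f : ι → V → ℝ) (hw : ∀ i, 0 ≤ w i) (hw1 : ∑ i, w i = 1)
    (sig : Finset ℝ) (hsig : ∀ θ ∈ sig, 0 ≤ θ ∧ θ ≤ 1) (hf : ∀ i v, f i v ∈ sig)
    (g : (V → ℝ) → ℝ) :
    (Scheme.ofFamily w f hw hw1 sig hsig hf).exp g = ∑ i, w i * g (f i) := by
  simp only [Scheme.exp, Scheme.ofFamily]
  rw [← sum_fiberwise_of_maps_to (fun i _ => mem_image_of_mem f (mem_univ i))]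
  refine sum_congr rfl fun s _ => ?_
  rw [sum_mul]
  refine sum_congr rfl fun i hi => ?_
  rw [(mem_filter.1 hi).2]

/-- The total excess of coverage over `1` at the vertices that receive signal `θ`. -/
noncomputable def excess [Fintype V] (W : V → V → ℝ) (θ : ℝ) (s : V → ℝ) : ℝ :=
  ∑ v, if s v = θ then ∑ u, W v u * s u - 1 else 0

theorem Scheme.slack_eq_exp_excess [Fintype V] [DecidableEq V] {W : V → V → ℝ}
    (hW : IsCollab W) (D : Scheme V) (θ : ℝ) :
    D.slack W θ = D.exp (excess W θ) := by
  simp only [Scheme.slack, Scheme.Contrib, Scheme.Num, Scheme.exp, mul_sum (a := 1 - θ),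
    ← sum_sub_distrib]
  refine sum_congr rfl fun s _ => ?_
  have h : ∀ v, (if s v = θ then ∑ u, W v u * s u - 1 else 0) =
      (if s v = θ then ∑ u ∈ univ.erase v, W v u * s u else 0) -
        (1 - θ) * (if s v = θ then (1 : ℝ) else 0) := by
    intro v
    split_ifs with hv
    · rw [← add_sum_erase univ (fun u => W v u * s u) (mem_univ v), hW.2.2 v, hv]
      ring
    · simp
  simp only [excess, h, sum_sub_distrib, ← mul_sum]
  ring

/-- The probability that independent inclusion with probabilities `q` produces the set `S`. -/
noncomputable def inclusionWeight [Fintype V] [DecidableEq V] (q : V → ℝ) (S : Finset V) : ℝ :=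
  (∏ v ∈ S, q v) * ∏ v ∈ univ \ S, (1 - q v)

theorem inclusionWeight_nonneg [Fintype V] [DecidableEq V] {q : V → ℝ} (h0 : ∀ v, 0 ≤ q v)
    (h1 : ∀ v, q v ≤ 1) (S : Finset V) : 0 ≤ inclusionWeight q S :=
  mul_nonneg (prod_nonneg fun v _ => h0 v) (prod_nonneg fun v _ => sub_nonneg.2 (h1 v))

theorem sum_inclusionWeight_superset [Fintype V] [DecidableEq V] (q : V → ℝ) (A : Finset V) :
    ∑ S, inclusionWeight q S * (if A ⊆ S then 1 else 0) = ∏ v ∈ A, q v := by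
  have h := prod_add q (fun v => (1 - q v) * (if v ∈ A then 0 else 1)) univ
  have hl : ∏ v, (q v + (1 - q v) * (if v ∈ A then 0 else 1)) = ∏ v ∈ A, q v := by
    rw [← prod_subset (subset_univ A)]
    · exact prod_congr rfl fun v hv => by simp [hv]
    · intro v _ hv
      simp [hv]
  rw [← hl, h, powerset_univ]
  refine sum_congr rfl fun S _ => ?_
  rw [inclusionWeight, mul_assoc, prod_mul_distrib]
  congr 2
  split_ifs with hA
  · refine (prod_eq_one fun v hv => ?_).symm
    have hv' : v ∉ A := fun h => (mem_sdiff.1 hv).2 (hA h)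
    simp [hv']
  · obtain ⟨v, hvA, hvS⟩ := not_subset.1 hA
    exact (prod_eq_zero (i := v) (by simp [hvS]) (by simp [hvA])).symm

theorem sum_inclusionWeight [Fintype V] [DecidableEq V] (q : V → ℝ) :
    ∑ S, inclusionWeight q S = 1 := by
  simpa using sum_inclusionWeight_superset q ∅

theorem sum_inclusionWeight_mem [Fintype V] [DecidableEq V] (q : V → ℝ) (v : V) :
    ∑ S, inclusionWeight q S * (if v ∈ S then 1 else 0) = q v := by
  simpa using sum_inclusionWeight_superset q {v}

theorem sum_inclusionWeight_mem_mem [Fintype V] [DecidableEq V] (q : V → ℝ) (v u : V) :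
    ∑ S, inclusionWeight q S * ((if v ∈ S then 1 else 0) * (if u ∈ S then 1 else 0)) =
      if u = v then q v else q v * q u := by
  split_ifs with h
  · subst h
    rw [← sum_inclusionWeight_mem q u]
    refine sum_congr rfl fun S _ => ?_
    split_ifs <;> simp
  · have := sum_inclusionWeight_superset q {v, u}
    rw [prod_pair (Ne.symm h)] at this
    rw [← this]
    refine sum_congr rfl fun S _ => ?_
    by_cases hv : v ∈ S <;> by_cases hu : u ∈ S <;> simp [insert_subset_iff, hv, hu]

/-- The signal function equal to `α` on `S` and `0` elsewhere. -/
noncomputable def levelSignal [DecidableEq V] (α : ℝ) (S : Finset V) (v : V) : ℝ :=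
  α * (if v ∈ S then 1 else 0)

theorem excess_levelSignal_self [Fintype V] [DecidableEq V] (W : V → V → ℝ) {α : ℝ}
    (hα : 0 < α) (S : Finset V) :
    excess W α (levelSignal α S) =
      α * ∑ v, ∑ u, W v u * ((if v ∈ S then 1 else 0) * (if u ∈ S then 1 else 0)) -
        ∑ v, if v ∈ S then 1 else 0 := by
  rw [mul_sum, ← sum_sub_distrib]
  refine sum_congr rfl fun v _ => ?_
  by_cases hv : v ∈ S
  · simp [levelSignal, hv, sum_mul, mul_comm α]
  · simp [levelSignal, hv, hα.ne]

theorem excess_levelSignal_zero [Fintype V] [DecidableEq V] (W : V → V → ℝ) {α : ℝ}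
    (hα : 0 < α) (S : Finset V) :
    excess W 0 (levelSignal α S) =
      α * ∑ v, ∑ u, W v u * (if u ∈ S then 1 else 0) - Fintype.card V -
        excess W α (levelSignal α S) := by
  have hc : (Fintype.card V : ℝ) = ∑ _v : V, (1 : ℝ) := by simp
  rw [hc, mul_sum, excess, excess, ← sum_sub_distrib, ← sum_sub_distrib]
  refine sum_congr rfl fun v _ => ?_
  have h : ∑ u, W v u * levelSignal α S u = α * ∑ u, W v u * (if u ∈ S then 1 else 0) := by
    rw [mul_sum]
    exact sum_congr rfl fun u _ => by rw [levelSignal]; ring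
  rw [h]
  by_cases hv : v ∈ S
  · simp [levelSignal, hv, hα.ne']
  · simp [levelSignal, hv, hα.ne]

theorem excess_levelSignal_of_ne [Fintype V] [DecidableEq V] (W : V → V → ℝ) {α θ : ℝ}
    (h0 : θ ≠ 0) (hα : θ ≠ α) (S : Finset V) : excess W θ (levelSignal α S) = 0 := by
  refine sum_eq_zero fun v _ => if_neg ?_
  by_cases hv : v ∈ S <;> simp [levelSignal, hv, h0.symm, hα.symm]

/-- The expected number of ordered adjacent pairs, weighted by `W`, of distinct vertices under
independent inclusion with probabilities `q`. -/
noncomputable def pairWeight [Fintype V] (W : V → V → ℝ) (q : V → ℝ) : ℝ :=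
  ∑ v, q v * ∑ u, W v u * q u - ∑ v, q v ^ 2

theorem sum_inclusionWeight_excess_self [Fintype V] [DecidableEq V] {W : V → V → ℝ}
    (hW : IsCollab W) {α : ℝ} (hα : 0 < α) (q : V → ℝ) :
    ∑ S, inclusionWeight q S * excess W α (levelSignal α S) =
      α * (∑ v, q v + pairWeight W q) - ∑ v, q v := by
  have h1 : ∑ S, inclusionWeight q S * ∑ v : V, (if v ∈ S then (1 : ℝ) else 0) = ∑ v, q v := by
    simp_rw [mul_sum]
    rw [sum_comm]
    exact sum_congr rfl fun v _ => sum_inclusionWeight_mem q v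
  have h2 : ∑ S, inclusionWeight q S *
      ∑ v, ∑ u, W v u * ((if v ∈ S then 1 else 0) * (if u ∈ S then 1 else 0)) =
      ∑ v, q v + pairWeight W q := by
    have : ∀ v, ∑ u, W v u * (if u = v then q v else q v * q u) =
        q v + (q v * ∑ u, W v u * q u - q v ^ 2) := by
      intro v
      rw [← add_sum_erase univ _ (mem_univ v),
        ← add_sum_erase univ (fun u => W v u * q u) (mem_univ v), hW.2.2 v, mul_add, mul_sum]
      rw [sum_congr rfl fun u hu => by rw [if_neg (ne_of_mem_erase hu), mul_left_comm]]
      simp only [if_true]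
      ring
    rw [pairWeight, ← sum_sub_distrib, ← sum_add_distrib, ← sum_congr rfl fun v _ => this v]
    simp_rw [mul_sum]
    rw [sum_comm]
    refine sum_congr rfl fun v _ => ?_
    rw [sum_comm]
    refine sum_congr rfl fun u _ => ?_
    rw [← sum_inclusionWeight_mem_mem, mul_sum]
    exact sum_congr rfl fun S _ => by ring
  simp_rw [excess_levelSignal_self W hα, mul_sub]
  rw [sum_sub_distrib, h1, ← h2, mul_sum]
  congr 1
  exact sum_congr rfl fun S _ => by ring

theorem sum_inclusionWeight_excess_zero [Fintype V] [DecidableEq V] (W : V → V → ℝ) {α : ℝ}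
    (hα : 0 < α) (q : V → ℝ) :
    ∑ S, inclusionWeight q S * excess W 0 (levelSignal α S) =
      α * ∑ v, ∑ u, W v u * q u - Fintype.card V -
        ∑ S, inclusionWeight q S * excess W α (levelSignal α S) := by
  have h : ∑ S, inclusionWeight q S * ∑ v, ∑ u, W v u * (if u ∈ S then 1 else 0) =
      ∑ v, ∑ u, W v u * q u := by
    simp_rw [mul_sum]
    rw [sum_comm]
    refine sum_congr rfl fun v _ => ?_
    rw [sum_comm]
    refine sum_congr rfl fun u _ => ?_
    rw [← sum_inclusionWeight_mem q u, mul_sum]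
    exact sum_congr rfl fun S _ => by ring
  simp_rw [excess_levelSignal_zero W hα, mul_sub]
  rw [sum_sub_distrib, sum_sub_distrib, ← h, ← sum_mul, sum_inclusionWeight, one_mul, mul_sum]
  congr 2
  exact sum_congr rfl fun S _ => by ring

theorem sum_inclusionWeight_sum_levelSignal [Fintype V] [DecidableEq V] (α : ℝ) (q : V → ℝ) :
    ∑ S, inclusionWeight q S * ∑ v, levelSignal α S v = α * ∑ v, q v := by
  simp_rw [levelSignal, mul_sum]
  rw [sum_comm]
  refine sum_congr rfl fun v _ => ?_
  rw [← sum_inclusionWeight_mem q v, mul_sum]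
  exact sum_congr rfl fun S _ => by ring

theorem Feasible.one_le_sum [Fintype V] [Nonempty V] {W : V → V → ℝ} (hW : IsCollab W)
    {θ : V → ℝ} (h : Feasible W θ) : 1 ≤ ∑ v, θ v := by
  obtain ⟨v⟩ := ‹Nonempty V›
  exact (h.2 v).trans (sum_le_sum fun u _ => mul_le_of_le_one_left (h.1 u) (hW.2.1 v u).2)

theorem Stable.le_one [Fintype V] [DecidableEq V] {W : V → V → ℝ} (hW : IsCollab W)
    {θ : V → ℝ} (h : Stable W θ) (v : V) : θ v ≤ 1 :=
  (h.2 v).2 ⟨zero_le_one, le_add_of_nonneg_right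
    (sum_nonneg fun u _ => mul_nonneg (hW.2.1 v u).1 (h.1.1 u))⟩

theorem Stable.coverage_eq_one [Fintype V] [DecidableEq V] {W : V → V → ℝ} (hW : IsCollab W)
    {θ : V → ℝ} (h : Stable W θ) {v : V} (hv : 0 < θ v) : ∑ u, W v u * θ u = 1 := by
  refine le_antisymm ?_ (h.1.2 v)
  by_contra! hlt
  have hs := add_sum_erase univ (fun u => W v u * θ u) (mem_univ v)
  rw [hW.2.2 v, one_mul] at hs
  have hmem : max 0 (1 - ∑ u ∈ univ.erase v, W v u * θ u) ∈
      {x : ℝ | 0 ≤ x ∧ 1 ≤ x + ∑ u ∈ univ.erase v, W v u * θ u} :=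
    ⟨le_max_left _ _, by linarith [le_max_right 0 (1 - ∑ u ∈ univ.erase v, W v u * θ u)]⟩
  exact absurd ((h.2 v).2 hmem) (not_le.2 (max_lt hv (by linarith)))

theorem Stable.excess_eq_zero [Fintype V] [DecidableEq V] {W : V → V → ℝ} (hW : IsCollab W)
    {θ : V → ℝ} (h : Stable W θ) {t : ℝ} (ht : 0 < t) : excess W t θ = 0 := by
  refine sum_eq_zero fun v _ => ?_
  split_ifs with hv
  · rw [h.coverage_eq_one hW (hv ▸ ht), sub_self]
  · rfl

/-- The excess of a stable solution at signal `0` controls its cost relative to any feasible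
solution. -/
theorem Stable.sum_le_mul_excess [Fintype V] [DecidableEq V] {W : V → V → ℝ} (hW : IsCollab W)
    {θ η : V → ℝ} (h : Stable W θ) (hη : Feasible W η) :
    ∑ v, θ v ≤ (∑ v, η v) * (excess W 0 θ + 1) := by
  have h1 : ∑ v, θ v ≤ ∑ v, η v * ∑ u, W v u * θ u := by
    have : ∑ v, η v * ∑ u, W v u * θ u = ∑ u, (∑ v, W u v * η v) * θ u := by
      simp_rw [mul_sum, sum_mul]
      rw [sum_comm]
      refine sum_congr rfl fun u _ => sum_congr rfl fun v _ => ?_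
      rw [hW.1 v u]
      ring
    rw [this]
    exact sum_le_sum fun u _ => le_mul_of_one_le_left (h.1.1 u) (hη.2 u)
  have h2 : ∑ v, η v * (∑ u, W v u * θ u - 1) ≤ (∑ v, η v) * excess W 0 θ := by
    rw [excess, mul_sum]
    refine sum_le_sum fun v _ => ?_
    split_ifs with hv
    · exact mul_le_mul_of_nonneg_right (single_le_sum (fun u _ => hη.1 u) (mem_univ v))
        (sub_nonneg.2 (h.1.2 v))
    · rw [h.coverage_eq_one hW (lt_of_le_of_ne (h.1.1 v) (Ne.symm hv))]
      simp
  simp_rw [mul_sub, mul_one] at h2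
  rw [sum_sub_distrib] at h2
  linarith

theorem exists_feasible_sum_eq_OPTIR [Fintype V] {W : V → V → ℝ} (hW : IsCollab W) :
    ∃ θ : V → ℝ, Feasible W θ ∧ (∀ v, θ v ≤ 1) ∧ ∑ v, θ v = OPTIR W := by
  let K : Set (V → ℝ) := Set.Icc 0 1 ∩ {θ | ∀ v, 1 ≤ ∑ u, W v u * θ u}
  have hK : IsCompact K := by
    refine isCompact_Icc.inter_right ?_
    simp only [Set.ofPred_forall]
    exact isClosed_iInter fun v => isClosed_le continuous_const (by fun_prop)
  have hne : K.Nonempty := by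
    refine ⟨1, ⟨zero_le_one, le_rfl⟩, fun v => ?_⟩
    have := single_le_sum (f := fun u => W v u * (1 : V → ℝ) u)
      (fun u _ => by simpa using (hW.2.1 v u).1) (mem_univ v)
    simpa [hW.2.2 v] using this
  obtain ⟨θ, hθ, hmin⟩ := hK.exists_isMinOn hne
    (f := fun θ : V → ℝ => ∑ v, θ v) (by fun_prop)
  refine ⟨θ, ⟨hθ.1.1, hθ.2⟩, hθ.1.2, ?_⟩
  have hleast : IsLeast {c : ℝ | ∃ θ : V → ℝ, Feasible W θ ∧ (∀ v, θ v ≤ 1) ∧ c = ∑ v, θ v}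
      (∑ v, θ v) := by
    refine ⟨⟨θ, ⟨hθ.1.1, hθ.2⟩, hθ.1.2, rfl⟩, ?_⟩
    rintro c ⟨η, hη, hη1, rfl⟩
    exact hmin ⟨⟨hη.1, hη1⟩, hη.2⟩
  exact hleast.csInf_eq.symm

theorem OPT_le_sum [Fintype V] (W : V → V → ℝ) {θ : V → ℝ} (h : Feasible W θ) :
    OPT W ≤ ∑ v, θ v :=
  csInf_le ⟨0, by rintro c ⟨η, hη, rfl⟩; exact sum_nonneg fun v _ => hη.1 v⟩ ⟨θ, h, rfl⟩

theorem le_OPT [Fintype V] {W : V → V → ℝ} {θ : V → ℝ} (hθ : Feasible W θ) {b : ℝ}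
    (h : ∀ η, Feasible W η → b ≤ ∑ v, η v) : b ≤ OPT W := by
  refine le_csInf ⟨_, θ, hθ, rfl⟩ ?_
  rintro c ⟨η, hη, rfl⟩
  exact h η hη

/-- Signalling a suitable common level to an independently included random set covers, in
expectation, enough of the total demand. -/
theorem Feasible.card_sub_le_coverage [Fintype V] [Nonempty V] {W : V → V → ℝ}
    (hW : IsCollab W) {q : V → ℝ} (h : Feasible W q) (h1 : ∀ v, q v ≤ 1) {k : ℝ}
    (hk : ∑ v, q v = k) :
    Fintype.card V - k * (Fintype.card V - k + 1) / (k + 1) ≤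
      k / (k + pairWeight W q) * ∑ v, ∑ u, W v u * q u := by
  set n : ℝ := (Fintype.card V : ℝ) with hn
  set s := ∑ v, q v ^ 2 with hs
  set A := ∑ v, q v * ∑ u, W v u * q u with hA
  have hk1 : 1 ≤ k := hk ▸ h.one_le_sum hW
  have hkn : k ≤ n := by
    rw [← hk, hn, ← nsmul_one, ← card_univ]
    exact sum_le_card_nsmul _ _ _ fun v _ => h1 v
  have hsn : k ^ 2 ≤ n * s := by
    have := sq_sum_le_card_mul_sum_sq (s := (univ : Finset V)) (f := q)
    rwa [hk, card_univ] at this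
  have hsk : s ≤ k := by
    rw [← hk]
    exact sum_le_sum fun v _ => by nlinarith [h.1 v, h1 v]
  have hs0 : 0 ≤ s := sum_nonneg fun v _ => sq_nonneg _
  have hkA : k ≤ A := by
    rw [← hk]
    exact sum_le_sum fun v _ => le_mul_of_one_le_right (h.1 v) (h.2 v)
  have hAk : A ≤ k ^ 2 := by
    rw [sq, ← hk, sum_mul]
    refine sum_le_sum fun v _ => mul_le_mul_of_nonneg_left ?_ (h.1 v)
    exact sum_le_sum fun u _ => mul_le_of_le_one_left (h.1 u) (hW.2.1 v u).2
  have hP : n - k + A ≤ ∑ v, ∑ u, W v u * q u := by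
    have hle : ∑ v, q v * (∑ u, W v u * q u - 1) ≤ ∑ v, (∑ u, W v u * q u - 1) :=
      sum_le_sum fun v _ => mul_le_of_le_one_left (sub_nonneg.2 (h.2 v)) (h1 v)
    simp_rw [mul_sub, mul_one] at hle
    rw [sum_sub_distrib, sum_sub_distrib, sum_const, card_univ, nsmul_one, hk] at hle
    linarith
  have hT : pairWeight W q = A - s := rfl
  have hn0 : 0 < n := by linarith
  have hab : k - s ≤ n - k := by
    have : 0 ≤ n * (n - 2 * k + s) := by nlinarith [sq_nonneg (n - k)]
    linarith [nonneg_of_mul_nonneg_right this hn0]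
  have hd : 0 < k + (A - s) := by linarith
  calc n - k * (n - k + 1) / (k + 1) = (n - k + k ^ 2) / (k + 1) := by
        field_simp
        ring
    _ ≤ k / (k + (A - s)) * (n - k + A) := by
        rw [div_mul_eq_mul_div, div_le_div_iff₀ (by linarith) hd]
        nlinarith [mul_nonneg (sub_nonneg.2 hab) (sub_nonneg.2 hAk),
          mul_nonneg (by linarith : 0 ≤ n - k + A) hs0]
    _ ≤ _ := by
        rw [hT]
        exact mul_le_mul_of_nonneg_left hP (by positivity)

theorem pairWeight_nonneg [Fintype V] {W : V → V → ℝ} (hW : IsCollab W) {q : V → ℝ}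
    (h : ∀ v, 0 ≤ q v) : 0 ≤ pairWeight W q := by
  rw [pairWeight, sub_nonneg]
  refine sum_le_sum fun v _ => ?_
  rw [sq]
  refine mul_le_mul_of_nonneg_left ?_ (h v)
  have := single_le_sum (f := fun u => W v u * q u)
    (fun u _ => mul_nonneg (hW.2.1 v u).1 (h u)) (mem_univ v)
  simpa [hW.2.2 v] using this

/-- Mixing a stable solution with the random level signal of a feasible IR solution is
persuasive once the excess of the former at signal `0` pays for the deficit of the latter. -/
theorem Stable.exists_persuasive_mixture [Fintype V] [DecidableEq V] [Nonempty V]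
    {W : V → V → ℝ} (hW : IsCollab W) {θ : V → ℝ} (hθ : Stable W θ) {v₀ : V} (hv₀ : θ v₀ = 0)
    {q : V → ℝ} (hq : Feasible W q) (hq1 : ∀ v, q v ≤ 1) {k : ℝ} (hk : ∑ v, q v = k)
    {ε : ℝ} (hε0 : 0 ≤ ε) (hε1 : ε ≤ 1)
    (hbal : ε * (k * (Fintype.card V - k + 1) / (k + 1)) ≤ (1 - ε) * excess W 0 θ) :
    ∃ D : Scheme V, D.sig.card ≤ Fintype.card V + 1 ∧ D.Persuasive W ∧
      D.cost ≤ ∑ v, θ v - ε * (∑ v, θ v - k) := by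
  have hk1 : 1 ≤ k := hk ▸ hq.one_le_sum hW
  have hT := pairWeight_nonneg hW hq.1
  set α := k / (k + pairWeight W q) with hα
  have hα0 : 0 < α := by positivity
  have hα1 : α ≤ 1 := div_le_one_of_le₀ (by linarith) (by linarith)
  have hself : ∑ S, inclusionWeight q S * excess W α (levelSignal α S) = 0 := by
    rw [sum_inclusionWeight_excess_self hW hα0, hk, hα, div_mul_cancel₀ _ (by positivity),
      sub_self]
  let w : Option (Finset V) → ℝ := fun o => o.elim (1 - ε) fun S => ε * inclusionWeight q S
  let f : Option (Finset V) → V → ℝ := fun o => o.elim θ (levelSignal α)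
  have hexp : ∀ g : (V → ℝ) → ℝ, ∑ o, w o * g (f o) =
      (1 - ε) * g θ + ε * ∑ S, inclusionWeight q S * g (levelSignal α S) := by
    intro g
    simp [Fintype.sum_option, w, f, mul_sum, mul_assoc]
  have hsum : ∑ o, w o = 1 := by
    have := hexp fun _ => 1
    simpa [sum_inclusionWeight] using this
  have hw : ∀ o, 0 ≤ w o := by
    rintro (_ | S)
    · exact sub_nonneg.2 hε1
    · exact mul_nonneg hε0 (inclusionWeight_nonneg hq.1 hq1 S)
  have hsig : ∀ t ∈ insert α (univ.image θ), 0 ≤ t ∧ t ≤ 1 := by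
    intro t ht
    rcases mem_insert.1 ht with rfl | ht
    · exact ⟨hα0.le, hα1⟩
    · obtain ⟨v, -, rfl⟩ := mem_image.1 ht
      exact ⟨hθ.1.1 v, hθ.le_one hW v⟩
  have hf : ∀ o v, f o v ∈ insert α (univ.image θ) := by
    rintro (_ | S) v
    · exact mem_insert_of_mem (mem_image_of_mem θ (mem_univ v))
    · by_cases hv : v ∈ S
      · simp [f, levelSignal, hv]
      · simpa [f, levelSignal, hv] using Or.inr ⟨v₀, hv₀⟩
  refine ⟨Scheme.ofFamily w f hw hsum _ hsig hf, ?_, ⟨fun t _ ht => ?_, fun _ => ?_⟩, ?_⟩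
  · exact (card_insert_le _ _).trans (Nat.add_le_add_right card_image_le 1)
  · rw [Scheme.slack_eq_exp_excess hW, Scheme.ofFamily_exp, hexp, hθ.excess_eq_zero hW ht]
    by_cases htα : t = α
    · rw [htα, hself]
      ring
    · simp [excess_levelSignal_of_ne W ht.ne' htα]
  · rw [Scheme.slack_eq_exp_excess hW, Scheme.ofFamily_exp, hexp,
      sum_inclusionWeight_excess_zero W hα0, hself]
    have := mul_le_mul_of_nonneg_left (hq.card_sub_le_coverage hW hq1 hk) hε0
    rw [← hα] at this
    linarith
  · rw [Scheme.cost, Scheme.ofFamily_exp, hexp, sum_inclusionWeight_sum_levelSignal, hk]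
    have := mul_le_mul_of_nonneg_left (mul_le_of_le_one_left (by linarith : 0 ≤ k) hα1) hε0
    linarith

/-- On a general weighted instance admitting an optimal stable solution
with `OPT^IR < OPT^stable`, setting `PoS = OPT^stable / OPT` and
`ε = (PoS − 1)/(PoS − 1 + OPT^IR·(n − OPT^IR + 1)/(OPT^IR + 1))`, we have `ε > 0` and there
is a persuasive identity-independent signaling scheme using at most `n + 1` signals with
`Cost(D) ≤ OPT^stable − ε·(OPT^stable − OPT^IR)`, hence `Cost(D) < OPT^stable`. -/
theorem statement8 (V : Type*) [Fintype V] [DecidableEq V] (W : V → V → ℝ)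
    (hW : IsCollab W)
    (θs : V → ℝ) (hθs : Stable W θs)
    (hopt : ∀ θ : V → ℝ, Stable W θ → ∑ v, θs v ≤ ∑ v, θ v)
    (hgap : OPTIR W < ∑ v, θs v) :
    let n : ℝ := (Fintype.card V : ℝ)
    let OPTstable : ℝ := ∑ v, θs v
    let PoS : ℝ := OPTstable / OPT W
    let ε : ℝ := (PoS - 1) / (PoS - 1 + OPTIR W * (n - OPTIR W + 1) / (OPTIR W + 1))
    0 < ε ∧ ∃ D : Scheme V, D.sig.card ≤ Fintype.card V + 1 ∧ D.Persuasive W ∧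
      D.cost ≤ OPTstable - ε * (OPTstable - OPTIR W) := by
  intro n OPTstable PoS ε
  have hV : Nonempty V := by
    by_contra hV
    rw [not_nonempty_iff] at hV
    obtain ⟨q, -, -, hq⟩ := exists_feasible_sum_eq_OPTIR hW
    simp [← hq] at hgap
  obtain ⟨q, hq, hq1, hk⟩ := exists_feasible_sum_eq_OPTIR hW
  have hOPT1 : 1 ≤ OPT W := le_OPT hq fun η hη => hη.one_le_sum hW
  have hOPTk : OPT W ≤ OPTIR W := hk ▸ OPT_le_sum W hq
  have hkn : OPTIR W ≤ n := by
    rw [← hk, show n = (Fintype.card V : ℝ) from rfl, ← nsmul_one, ← card_univ]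
    exact sum_le_card_nsmul _ _ _ fun v _ => hq1 v
  have hPoS : 0 < PoS - 1 :=
    sub_pos.2 ((one_lt_div (by linarith)).2 (hOPTk.trans_lt hgap))
  have hexc0 : 0 ≤ excess W 0 θs := by
    refine sum_nonneg fun v _ => ?_
    split_ifs
    · exact sub_nonneg.2 (hθs.1.2 v)
    · exact le_rfl
  have hexc : PoS - 1 ≤ excess W 0 θs := by
    have : OPTstable / (excess W 0 θs + 1) ≤ OPT W := le_OPT hq fun η hη =>
      (div_le_iff₀ (by linarith)).2 (hθs.sum_le_mul_excess hW hη)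
    rw [div_le_iff₀ (by linarith)] at this
    rw [sub_le_iff_le_add, div_le_iff₀ (by linarith)]
    linarith
  have hX : 0 < OPTIR W * (n - OPTIR W + 1) / (OPTIR W + 1) :=
    div_pos (mul_pos (by linarith) (by linarith)) (by linarith)
  have hε0 : 0 < ε := div_pos hPoS (by linarith)
  have hε1 : ε ≤ 1 := div_le_one_of_le₀ (by linarith) (by linarith)
  have hbal : ε * (OPTIR W * (n - OPTIR W + 1) / (OPTIR W + 1)) = (1 - ε) * (PoS - 1) := by
    have : ε * (PoS - 1 + OPTIR W * (n - OPTIR W + 1) / (OPTIR W + 1)) = PoS - 1 :=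
      div_mul_cancel₀ _ (by linarith)
    linarith
  obtain ⟨v₀, hv₀⟩ : ∃ v, θs v = 0 := by
    by_contra! hne
    have : excess W 0 θs = 0 := sum_eq_zero fun v _ => if_neg (hne v)
    linarith
  exact ⟨hε0, hθs.exists_persuasive_mixture hW hv₀ hq hq1 hk hε0.le hε1
    (hbal.trans_le (mul_le_mul_of_nonneg_left hexc (sub_nonneg.2 hε1)))⟩
end

section
/- There exist universal constants c₁, c₂, c₃, c₄ > 0 and an integer n₀ such that for all integers n ≥ n₀ and 2 ≤ k ≤ n, there is a unit-weight collaboration instance on at most n vertices for which the following hold simultaneously: c₁·k ≤ OPT ≤ c₂·k; OPT^stable ≥ c₃·n; and every persuasive identity-independent signaling scheme (with any finite signal space Σ ⊆ [0,1]) has cost at least c₄ · min{k·√n, n}. -/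
open Finset

variable {V : Type*}

/-! ### Linear functionals of a scheme -/

lemma Scheme.exp_mono [Fintype V] (D : Scheme V) {f g : (V → ℝ) → ℝ}
    (h : ∀ s ∈ D.supp, f s ≤ g s) : D.exp f ≤ D.exp g :=
  Finset.sum_le_sum fun s hs => mul_le_mul_of_nonneg_left (h s hs) (D.p_nonneg s hs)

lemma Scheme.exp_affine [Fintype V] (D : Scheme V) (a b c : ℝ) (f g : (V → ℝ) → ℝ) :
    D.exp (fun s => a + b * f s + c * g s) = a + b * D.exp f + c * D.exp g := by
  have h : ∀ s, D.p s * (a + b * f s + c * g s)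
      = a * D.p s + b * (D.p s * f s) + c * (D.p s * g s) := fun s => by ring
  simp only [Scheme.exp, h, Finset.sum_add_distrib, ← Finset.mul_sum, D.p_sum, mul_one]

lemma sum_erase_eq_sub [Fintype V] [DecidableEq V] {W : V → V → ℝ} (hW : ∀ v, W v v = 1)
    (s : V → ℝ) (v : V) :
    ∑ u ∈ Finset.univ.erase v, W v u * s u = ∑ u, W v u * s u - s v := by
  rw [← Finset.add_sum_erase _ _ (Finset.mem_univ v), hW]
  ring

lemma Scheme.slack_eq_exp [Fintype V] [DecidableEq V] (D : Scheme V) {W : V → V → ℝ}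
    (hW : ∀ v, W v v = 1) (θ : ℝ) :
    D.slack W θ = D.exp (fun s => ∑ v, if s v = θ then ∑ u, W v u * s u - 1 else 0) := by
  simp only [Scheme.slack, Scheme.Contrib, Scheme.Num, Scheme.exp, Finset.mul_sum]
  rw [← Finset.sum_sub_distrib]
  refine Finset.sum_congr rfl fun s _ => ?_
  rw [← Finset.sum_sub_distrib]
  refine Finset.sum_congr rfl fun v _ => ?_
  rw [sum_erase_eq_sub hW]
  split_ifs with h
  · rw [h]; ring
  · ring

/-- A weighted combination of the slacks is the expectation of the weighted excesses. -/
lemma Scheme.sum_mul_slack [Fintype V] [DecidableEq V] (D : Scheme V) {W : V → V → ℝ}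
    (hW : ∀ v, W v v = 1) (φ : ℝ → ℝ) :
    ∑ θ ∈ D.sig, φ θ * D.slack W θ
      = D.exp (fun s => ∑ v, φ (s v) * (∑ u, W v u * s u - 1)) := by
  simp only [D.slack_eq_exp hW, Scheme.exp]
  simp_rw [Finset.mul_sum (s := D.supp)]
  rw [Finset.sum_comm]
  refine Finset.sum_congr rfl fun s hs => ?_
  simp_rw [mul_left_comm (φ _) (D.p s)]
  rw [← Finset.mul_sum]
  congr 1
  simp_rw [Finset.mul_sum (s := (Finset.univ : Finset V))]
  rw [Finset.sum_comm]
  refine Finset.sum_congr rfl fun v _ => ?_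
  rw [Finset.sum_eq_single (s v)]
  · simp
  · intro θ _ hθ
    simp [hθ.symm]
  · intro h
    exact absurd (D.val_mem s hs v) h

lemma Scheme.Persuasive.exp_nonneg [Fintype V] [DecidableEq V] {D : Scheme V} {W : V → V → ℝ}
    (hD : D.Persuasive W) (hW : ∀ v, W v v = 1) {φ : ℝ → ℝ} (hφ : 0 ≤ φ 0) :
    0 ≤ D.exp (fun s => ∑ v, φ (s v) * (∑ u, W v u * s u - 1)) := by
  rw [← D.sum_mul_slack hW]
  refine Finset.sum_nonneg fun θ hθ => ?_
  rcases (D.sig_mem θ hθ).1.eq_or_lt with h | h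
  · subst h
    exact mul_nonneg hφ (hD.2 hθ)
  · rw [hD.1 θ hθ h, mul_zero]

lemma stable_iff [Fintype V] [DecidableEq V] {W : V → V → ℝ} (hW : ∀ v, W v v = 1)
    (θ : V → ℝ) :
    Stable W θ ↔ (∀ v, 0 ≤ θ v) ∧ (∀ v, 1 ≤ ∑ u, W v u * θ u) ∧
      ∀ v, 0 < θ v → ∑ u, W v u * θ u ≤ 1 := by
  simp only [Stable, Feasible, sum_erase_eq_sub hW]
  constructor
  · rintro ⟨⟨h0, h1⟩, h2⟩
    refine ⟨h0, h1, fun v hv => ?_⟩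
    by_contra! hlt
    have hmem : max 0 (1 - (∑ u, W v u * θ u - θ v)) ∈
        {x : ℝ | 0 ≤ x ∧ 1 ≤ x + (∑ u, W v u * θ u - θ v)} :=
      ⟨le_max_left _ _, by linarith [le_max_right 0 (1 - (∑ u, W v u * θ u - θ v))]⟩
    have hle := (h2 v).2 hmem
    have : max 0 (1 - (∑ u, W v u * θ u - θ v)) < θ v := max_lt hv (by linarith)
    linarith
  · rintro ⟨h0, h1, h2⟩
    refine ⟨⟨h0, h1⟩, fun v => ⟨⟨h0 v, by linarith [h1 v]⟩, ?_⟩⟩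
    rintro x ⟨hx0, hx1⟩
    rcases (h0 v).eq_or_lt with h | h
    · rw [← h]; exact hx0
    · linarith [h2 v h]

/-! ### A clique of hubs with pendant leaves, plus isolated vertices -/

/-- Vertices: `K` hubs, `L` leaves at each hub, and `I` isolated vertices. -/
abbrev HubVertex (K L I : ℕ) : Type := Fin K ⊕ ((Fin K × Fin L) ⊕ Fin I)

/-- The hubs form a clique, each leaf is joined to its hub, and there are no further edges. -/
def hubWeight (K L I : ℕ) : HubVertex K L I → HubVertex K L I → ℝ
  | .inl _, .inl _ => 1
  | .inl h, .inr (.inl q) => if q.1 = h then 1 else 0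
  | .inr (.inl q), .inl h => if q.1 = h then 1 else 0
  | .inr (.inl p), .inr (.inl q) => if p = q then 1 else 0
  | .inr (.inr i), .inr (.inr j) => if i = j then 1 else 0
  | .inl _, .inr (.inr _) => 0
  | .inr (.inr _), .inl _ => 0
  | .inr (.inl _), .inr (.inr _) => 0
  | .inr (.inr _), .inr (.inl _) => 0

section HubGraph

variable {K L I : ℕ}

lemma hubWeight_symm (u v : HubVertex K L I) : hubWeight K L I u v = hubWeight K L I v u := by
  rcases u with h | p | i <;> rcases v with h' | q | j <;> simp [hubWeight, eq_comm]

lemma hubWeight_zero_or_one (u v : HubVertex K L I) :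
    hubWeight K L I u v = 0 ∨ hubWeight K L I u v = 1 := by
  rcases u with h | p | i <;> rcases v with h' | q | j <;> simp only [hubWeight] <;>
    first
      | (split_ifs <;> simp)
      | simp

lemma hubWeight_self (v : HubVertex K L I) : hubWeight K L I v v = 1 := by
  rcases v with h | p | i <;> simp [hubWeight]

lemma sum_hubVertex (f : HubVertex K L I → ℝ) :
    ∑ v, f v = ∑ h, f (.inl h) + (∑ h, ∑ j, f (.inr (.inl (h, j))) + ∑ i, f (.inr (.inr i))) := by
  simp [Fintype.sum_sum_type, Fintype.sum_prod_type]

lemma row_hub (t : HubVertex K L I → ℝ) (h : Fin K) :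
    ∑ u, hubWeight K L I (.inl h) u * t u
      = ∑ h', t (.inl h') + ∑ j, t (.inr (.inl (h, j))) := by
  rw [sum_hubVertex]
  simp [hubWeight]

lemma row_leaf (t : HubVertex K L I → ℝ) (h : Fin K) (j : Fin L) :
    ∑ u, hubWeight K L I (.inr (.inl (h, j))) u * t u
      = t (.inl h) + t (.inr (.inl (h, j))) := by
  simp [Fintype.sum_sum_type, hubWeight]

lemma row_isolated (t : HubVertex K L I → ℝ) (i : Fin I) :
    ∑ u, hubWeight K L I (.inr (.inr i)) u * t u = t (.inr (.inr i)) := by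
  simp [Fintype.sum_sum_type, hubWeight]

/-- Weighting the excess of each vertex by one minus its value bounds the deficit of the hubs. -/
lemma sum_one_sub_mul_excess_le {t : HubVertex K L I → ℝ} (h0 : ∀ v, 0 ≤ t v)
    (h1 : ∀ v, t v ≤ 1) :
    ∑ v, (1 - t v) * (∑ u, hubWeight K L I v u * t u - 1)
      ≤ 3 * ∑ v, t v - (L - K) * (K - ∑ h, t (.inl h)) := by
  rw [sum_hubVertex, sum_hubVertex t]
  simp only [row_hub, row_leaf, row_isolated]
  set X := ∑ h, t (.inl h) with hX
  have hX0 : 0 ≤ X := Finset.sum_nonneg fun h _ => h0 _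
  have hXK : X ≤ K := by
    have := Finset.sum_le_sum (s := Finset.univ)
      fun h (_ : h ∈ Finset.univ) => h1 (.inl h : HubVertex K L I)
    simpa using this
  have hhub : ∑ h, (1 - t (.inl h)) * (X + ∑ j, t (.inr (.inl (h, j))) - 1)
      ≤ K * (K - X) + ∑ h, ∑ j, t (.inr (.inl (h, j))) := by
    have : ∀ h : Fin K, (1 - t (.inl h)) * (X + ∑ j, t (.inr (.inl (h, j))) - 1)
        ≤ K * (1 - t (.inl h)) + ∑ j, t (.inr (.inl (h, j))) := by
      intro h
      have hY : 0 ≤ ∑ j, t (.inr (.inl (h, j))) := Finset.sum_nonneg fun j _ => h0 _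
      nlinarith [h0 (.inl h), h1 (.inl h), mul_nonneg (h0 (.inl h)) hY,
        mul_nonneg (sub_nonneg.2 (h1 (.inl h))) (sub_nonneg.2 hXK)]
    refine (Finset.sum_le_sum fun h _ => this h).trans_eq ?_
    rw [Finset.sum_add_distrib, ← Finset.mul_sum, Finset.sum_sub_distrib]
    simp [hX]
  have hleaf : ∑ h, ∑ j, (1 - t (.inr (.inl (h, j)))) *
        (t (.inl h) + t (.inr (.inl (h, j))) - 1)
      ≤ 2 * ∑ h, ∑ j, t (.inr (.inl (h, j))) - L * (K - X) := by
    have : ∀ (h : Fin K) (j : Fin L), (1 - t (.inr (.inl (h, j)))) *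
        (t (.inl h) + t (.inr (.inl (h, j))) - 1)
        ≤ 2 * t (.inr (.inl (h, j))) - (1 - t (.inl h)) := by
      intro h j
      nlinarith [h0 (.inl h), h0 (.inr (.inl (h, j))), mul_nonneg (h0 (.inl h))
        (h0 (.inr (.inl (h, j)))), sq_nonneg (t (.inr (.inl (h, j))))]
    refine (Finset.sum_le_sum fun h _ => Finset.sum_le_sum fun j _ => this h j).trans_eq ?_
    simp only [Finset.sum_sub_distrib, ← Finset.mul_sum, Finset.sum_const, Finset.card_univ,
      Fintype.card_fin, nsmul_eq_mul, hX]
    ring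
  have hiso : ∑ i, (1 - t (.inr (.inr i))) * (t (.inr (.inr i)) - 1) ≤ 0 :=
    Finset.sum_nonpos fun i _ => by nlinarith [sq_nonneg (1 - t (.inr (.inr i)))]
  have hz : 0 ≤ ∑ i, t (.inr (.inr i)) := Finset.sum_nonneg fun i _ => h0 _
  linarith

/-- The excess at the vertices of value at least `1 - η` is large unless the hubs are far from
saturated or the total value is large. -/
lemma le_sum_indicator_mul_excess (hK : 2 ≤ K) {η : ℝ} (hη0 : 0 < η) (hη : η ≤ 1 / 10)
    {t : HubVertex K L I → ℝ} (h0 : ∀ v, 0 ≤ t v) (h1 : ∀ v, t v ≤ 1) :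
    (1.62 * K - 1) * (K - (K - ∑ h, t (.inl h)) / η) - 0.729 * (K : ℝ) ^ 2
        - 10 / 9 * η * ∑ v, t v
      ≤ ∑ v, (if 1 - η ≤ t v then 1 else 0) * (∑ u, hubWeight K L I v u * t u - 1) := by
  rw [sum_hubVertex t, sum_hubVertex]
  simp only [row_hub, row_leaf, row_isolated]
  set X := ∑ h, t (.inl h) with hX
  set G : ℝ := ∑ h : Fin K, if 1 - η ≤ t (.inl h) then 1 else 0 with hG
  have hX0 : 0 ≤ X := Finset.sum_nonneg fun h _ => h0 _
  have hG0 : 0 ≤ G := Finset.sum_nonneg fun h _ => by split_ifs <;> norm_num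
  have hGX : 0.9 * G ≤ X := by
    rw [hG, hX, Finset.mul_sum]
    refine Finset.sum_le_sum fun h _ => ?_
    split_ifs <;> linarith [h0 (.inl h)]
  have hGK : K - (K - X) / η ≤ G := by
    have hpt : ∀ h : Fin K, 1 - (1 - t (.inl h)) / η ≤ if 1 - η ≤ t (.inl h) then 1 else 0 := by
      intro h
      split_ifs with hh
      · have := div_nonneg (sub_nonneg.2 (h1 (.inl h))) hη0.le
        linarith
      · have : 1 ≤ (1 - t (.inl h)) / η := by
          rw [le_div_iff₀ hη0]; linarith
        linarith
    have := Finset.sum_le_sum (s := Finset.univ) fun h (_ : h ∈ Finset.univ) => hpt h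
    rw [← hG, Finset.sum_sub_distrib, ← Finset.sum_div, Finset.sum_sub_distrib, ← hX] at this
    simpa only [Finset.sum_const, Finset.card_univ, Fintype.card_fin, nsmul_eq_mul, mul_one]
      using this
  have hhub : G * (0.9 * G - 1) ≤ ∑ h, (if 1 - η ≤ t (.inl h) then 1 else 0) *
      (X + ∑ j, t (.inr (.inl (h, j))) - 1) := by
    rw [hG, Finset.sum_mul, ← hG]
    refine Finset.sum_le_sum fun h _ => mul_le_mul_of_nonneg_left ?_ (by split_ifs <;> norm_num)
    have hY : 0 ≤ ∑ j, t (.inr (.inl (h, j))) := Finset.sum_nonneg fun j _ => h0 _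
    linarith
  have hlow : ∀ x y : ℝ, 0 ≤ x → 0 ≤ y →
      -(10 / 9 * η * y) ≤ (if 1 - η ≤ y then 1 else 0) * (x + y - 1) := by
    intro x y hx hy
    split_ifs with hh
    · nlinarith
    · nlinarith [mul_nonneg hη0.le hy]
  have hleaf : -(10 / 9 * η * ∑ h, ∑ j, t (.inr (.inl (h, j)))) ≤
      ∑ h, ∑ j, (if 1 - η ≤ t (.inr (.inl (h, j))) then 1 else 0) *
        (t (.inl h) + t (.inr (.inl (h, j))) - 1) := by
    simp only [Finset.mul_sum, ← Finset.sum_neg_distrib]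
    exact Finset.sum_le_sum fun h _ => Finset.sum_le_sum fun j _ => hlow _ _ (h0 _) (h0 _)
  have hiso : -(10 / 9 * η * ∑ i, t (.inr (.inr i))) ≤
      ∑ i, (if 1 - η ≤ t (.inr (.inr i)) then 1 else 0) * (t (.inr (.inr i)) - 1) := by
    simp only [Finset.mul_sum, ← Finset.sum_neg_distrib]
    exact Finset.sum_le_sum fun i _ => by simpa using hlow 0 _ le_rfl (h0 (.inr (.inr i)))
  have hK' : (2 : ℝ) ≤ K := by exact_mod_cast hK
  have hquad : (1.62 * K - 1) * (K - (K - X) / η) - 0.729 * (K : ℝ) ^ 2 ≤ G * (0.9 * G - 1) := by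
    have := mul_le_mul_of_nonneg_left hGK (by linarith : (0 : ℝ) ≤ 1.62 * K - 1)
    nlinarith [sq_nonneg (G - 0.9 * K)]
  have : 0 ≤ 10 / 9 * η * X := by positivity
  linarith

lemma card_le_sum_of_feasible (hL : 0 < L) {t : HubVertex K L I → ℝ} (h0 : ∀ v, 0 ≤ t v)
    (h1 : ∀ v, 1 ≤ ∑ u, hubWeight K L I v u * t u) : (K : ℝ) + I ≤ ∑ v, t v := by
  rw [sum_hubVertex]
  have hpair : (K : ℝ) ≤ ∑ h, t (.inl h) + ∑ h, ∑ j, t (.inr (.inl (h, j))) := by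
    rw [← Finset.sum_add_distrib]
    have : ∀ h : Fin K, 1 ≤ t (.inl h) + ∑ j, t (.inr (.inl (h, j))) := by
      intro h
      have h2 := h1 (.inr (.inl (h, ⟨0, hL⟩)))
      rw [row_leaf] at h2
      have := Finset.single_le_sum (s := Finset.univ) (f := fun j => t (.inr (.inl (h, j))))
        (fun j _ => h0 _) (Finset.mem_univ ⟨0, hL⟩)
      linarith
    simpa using Finset.sum_le_sum (s := Finset.univ) fun h (_ : h ∈ Finset.univ) => this h
  have hiso : (I : ℝ) ≤ ∑ i, t (.inr (.inr i)) := by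
    have : ∀ i : Fin I, 1 ≤ t (.inr (.inr i)) := fun i => by
      simpa only [row_isolated] using h1 (.inr (.inr i))
    simpa using Finset.sum_le_sum (s := Finset.univ) fun i (_ : i ∈ Finset.univ) => this i
  linarith

lemma le_sum_of_stable {t : HubVertex K L I → ℝ} (h0 : ∀ v, 0 ≤ t v)
    (h1 : ∀ v, 1 ≤ ∑ u, hubWeight K L I v u * t u)
    (h2 : ∀ v, 0 < t v → ∑ u, hubWeight K L I v u * t u ≤ 1) :
    (L : ℝ) * (K - 1) ≤ ∑ v, t v := by
  have hX : ∑ h, t (.inl h) ≤ 1 := by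
    by_cases hpos : ∃ h, 0 < t (.inl h)
    · obtain ⟨h, hh⟩ := hpos
      have h3 := h2 _ hh
      rw [row_hub] at h3
      have hY : 0 ≤ ∑ j, t (.inr (.inl (h, j))) := Finset.sum_nonneg fun j _ => h0 _
      linarith
    · push Not at hpos
      exact (Finset.sum_nonpos fun h _ => hpos h).trans zero_le_one
  have hleaf : (L : ℝ) * (K - ∑ h, t (.inl h)) ≤ ∑ h, ∑ j, t (.inr (.inl (h, j))) := by
    have : ∀ (h : Fin K) (j : Fin L), 1 - t (.inl h) ≤ t (.inr (.inl (h, j))) := fun h j => by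
      have h3 := h1 (.inr (.inl (h, j)))
      rw [row_leaf] at h3
      linarith
    refine Eq.trans_le ?_ (Finset.sum_le_sum fun h _ => Finset.sum_le_sum fun j _ => this h j)
    simp only [Finset.sum_const, Finset.card_univ, Fintype.card_fin, nsmul_eq_mul,
      ← Finset.mul_sum, Finset.sum_sub_distrib, mul_one]
  have hX0 : 0 ≤ ∑ h, t (.inl h) := Finset.sum_nonneg fun h _ => h0 _
  have hz : 0 ≤ ∑ i, t (.inr (.inr i)) := Finset.sum_nonneg fun i _ => h0 _
  have := mul_le_mul_of_nonneg_left (sub_le_sub_left hX (K : ℝ)) (Nat.cast_nonneg (α := ℝ) L)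
  rw [sum_hubVertex]
  linarith

/-- The solution in which the hub `a`, the leaves of all other hubs and the isolated vertices
contribute one, and nobody else contributes. -/
def singleHubSolution (a : Fin K) : HubVertex K L I → ℝ
  | .inl h => if h = a then 1 else 0
  | .inr (.inl q) => if q.1 = a then 0 else 1
  | .inr (.inr _) => 1

lemma singleHubSolution_spec (a : Fin K) :
    (∀ v, 0 ≤ singleHubSolution (L := L) (I := I) a v) ∧
    (∀ v, 1 ≤ ∑ u, hubWeight K L I v u * singleHubSolution a u) ∧
    ∀ v, 0 < singleHubSolution a v → ∑ u, hubWeight K L I v u * singleHubSolution a u ≤ 1 := by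
  refine ⟨?_, ?_, ?_⟩
  · rintro (h | q | i) <;> simp only [singleHubSolution] <;> (try split_ifs) <;> norm_num
  · rintro (h | q | i)
    · rw [row_hub]
      by_cases h = a <;> simp [singleHubSolution, *]
    · rw [row_leaf]
      by_cases q.1 = a <;> simp [singleHubSolution, *]
    · rw [row_isolated]
      simp [singleHubSolution]
  · rintro (h | q | i)
    · rw [row_hub]
      by_cases h = a <;> simp [singleHubSolution, *]
    · rw [row_leaf]
      by_cases q.1 = a <;> simp [singleHubSolution, *]
    · rw [row_isolated]
      simp [singleHubSolution]

/-! ### The instance on an arbitrary relabelling of the vertices -/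

variable (e : V ≃ HubVertex K L I)

/-- The hub graph with its vertices relabelled along `e`. -/
def relabelledWeight : V → V → ℝ := fun u v => hubWeight K L I (e u) (e v)

lemma relabelledWeight_self (v : V) : relabelledWeight e v v = 1 := hubWeight_self _

lemma row_relabelled [Fintype V] (s : V → ℝ) (v : V) :
    ∑ u, relabelledWeight e v u * s u = ∑ b, hubWeight K L I (e v) b * s (e.symm b) := by
  rw [← e.sum_comp]
  simp [relabelledWeight]

lemma sum_mul_excess_relabelled [Fintype V] (φ : ℝ → ℝ) (s : V → ℝ) :
    ∑ v, φ (s v) * (∑ u, relabelledWeight e v u * s u - 1)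
      = ∑ a, φ (s (e.symm a)) * (∑ b, hubWeight K L I a b * s (e.symm b) - 1) := by
  simp only [row_relabelled]
  rw [← e.sum_comp]
  simp

/-- A persuasive scheme on the hub graph is expensive: either its cost is a constant fraction of
the number of leaves, or at least a multiple of the number of hubs times the square root of it. -/
lemma Scheme.Persuasive.cost_lower_bound [Fintype V] [DecidableEq V] (hK : 2 ≤ K) (hL : 2 * K ≤ L)
    {D : Scheme V} (hD : D.Persuasive (relabelledWeight e)) :
    (K * L : ℝ) ≤ 600 * D.cost ∨ (K : ℝ) ^ 2 * (K * L) ≤ 240 * D.cost ^ 2 := by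
  have hK' : (2 : ℝ) ≤ K := by exact_mod_cast hK
  have hL' : 2 * (K : ℝ) ≤ L := by exact_mod_cast hL
  have hmem : ∀ s ∈ D.supp, (∀ a, 0 ≤ s (e.symm a)) ∧ ∀ a, s (e.symm a) ≤ 1 := fun s hs =>
    ⟨fun a => (D.sig_mem _ (D.val_mem s hs _)).1, fun a => (D.sig_mem _ (D.val_mem s hs _)).2⟩
  set EX := D.exp (fun s => ∑ h, s (e.symm (.inl h))) with hEX
  have hcost : D.cost = D.exp (fun s => ∑ a, s (e.symm a)) := by
    simp only [Scheme.cost, e.symm.sum_comp]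
  have hdef : (L - K) * (K - EX) ≤ 3 * D.cost := by
    have h := hD.exp_nonneg (relabelledWeight_self e) (φ := fun x => 1 - x) (by norm_num)
    have h' := D.exp_mono (f := fun s => ∑ v, (1 - s v) * (∑ u, relabelledWeight e v u * s u - 1))
      (g := fun s => -((L - K) * K : ℝ) + 3 * (∑ a, s (e.symm a))
        + (L - K : ℝ) * (∑ h, s (e.symm (.inl h)))) (fun s hs => by
        rw [sum_mul_excess_relabelled e (fun x => 1 - x)]
        have := sum_one_sub_mul_excess_le (hmem s hs).1 (hmem s hs).2
        linarith)
    rw [D.exp_affine, ← hcost, ← hEX] at h'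
    linarith
  have hEXC : EX ≤ D.cost := by
    rw [hcost]
    refine D.exp_mono fun s hs => ?_
    rw [sum_hubVertex]
    have hy : 0 ≤ ∑ h, ∑ j, s (e.symm (.inr (.inl (h, j)))) :=
      Finset.sum_nonneg fun h _ => Finset.sum_nonneg fun j _ => (hmem s hs).1 _
    have hz : 0 ≤ ∑ i, s (e.symm (.inr (.inr i))) := Finset.sum_nonneg fun i _ => (hmem s hs).1 _
    linarith
  have hEXK : EX ≤ K := by
    have h' := D.exp_mono (f := fun s => ∑ h, s (e.symm (.inl h)))
      (g := fun s => (K : ℝ) + 0 * 0 + 0 * 0) (fun s hs => by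
        have := Finset.sum_le_sum (s := Finset.univ)
          fun (h : Fin K) (_ : h ∈ Finset.univ) => (hmem s hs).2 (.inl h)
        simpa using this)
    rw [D.exp_affine] at h'
    linarith
  have hdef2 : L * (K - EX) ≤ 6 * D.cost := by
    nlinarith [mul_nonneg (sub_nonneg.2 hL') (sub_nonneg.2 hEXK)]
  have hC : 0 < D.cost := by
    by_contra! hneg
    nlinarith
  have hKL : (0 : ℝ) < K * L := by nlinarith
  by_cases hη : 60 * D.cost / (K * L) ≤ 1 / 10
  · right
    have hη0 : 0 < 60 * D.cost / (K * L) := by positivity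
    set η := 60 * D.cost / (K * L) with hηdef
    have hηKL : η * (K * L) = 60 * D.cost := by
      rw [hηdef, div_mul_cancel₀ _ hKL.ne']
    have h := hD.exp_nonneg (relabelledWeight_self e)
      (φ := fun x => -(if 1 - η ≤ x then 1 else 0)) (by rw [if_neg (by linarith)]; norm_num)
    have h' := D.exp_mono (f := fun s => ∑ v, -(if 1 - η ≤ s v then 1 else 0) *
        (∑ u, relabelledWeight e v u * s u - 1))
      (g := fun s => -((1.62 * K - 1) * (K - K / η) - 0.729 * (K : ℝ) ^ 2)
        + 10 / 9 * η * (∑ a, s (e.symm a))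
        + -((1.62 * K - 1) / η) * (∑ h, s (e.symm (.inl h)))) (fun s hs => by
        rw [sum_mul_excess_relabelled e (fun x => -(if 1 - η ≤ x then 1 else 0))]
        simp only [neg_mul, Finset.sum_neg_distrib]
        have := le_sum_indicator_mul_excess hK hη0 hη (hmem s hs).1 (hmem s hs).2
        refine (neg_le_neg this).trans_eq ?_
        ring)
    rw [D.exp_affine, ← hcost, ← hEX] at h'
    have hratio : (K - EX) / η ≤ K / 10 := by
      rw [div_le_iff₀ hη0]
      nlinarith
    have hmain : (1.62 * K - 1) * (K - (K - EX) / η) - 0.729 * (K : ℝ) ^ 2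
        ≤ 10 / 9 * η * D.cost := by
      have : (1.62 * K - 1) * (K - (K - EX) / η) = (1.62 * K - 1) * (K - K / η)
        + (1.62 * K - 1) / η * EX := by ring
      linarith
    have hlow := mul_le_mul_of_nonneg_left (sub_le_sub_left hratio (K : ℝ))
      (by linarith : (0 : ℝ) ≤ 1.62 * K - 1)
    have hsq : 0.279 * (K : ℝ) ^ 2 ≤ 10 / 9 * η * D.cost := by nlinarith
    have := mul_le_mul_of_nonneg_right hsq hKL.le
    have hrw : 10 / 9 * η * D.cost * (K * L) = 10 / 9 * D.cost * (60 * D.cost) := by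
      rw [← hηKL]; ring
    nlinarith
  · left
    push Not at hη
    rw [lt_div_iff₀ hKL] at hη
    linarith

end HubGraph

/-- There exist universal constants `c₁, c₂, c₃, c₄ > 0` and `n₀` such
that for all `n ≥ n₀` and `2 ≤ k ≤ n`, there is a unit-weight collaboration instance on at
most `n` vertices with `c₁·k ≤ OPT ≤ c₂·k`, stable solutions exist and all have total
workload at least `c₃·n` (i.e. `OPT^stable ≥ c₃·n`), and every persuasive
identity-independent signaling scheme has cost at least `c₄·min{k·√n, n}`. -/
theorem statement9 :
    ∃ (c₁ c₂ c₃ c₄ : ℝ) (n₀ : ℕ), 0 < c₁ ∧ 0 < c₂ ∧ 0 < c₃ ∧ 0 < c₄ ∧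
      ∀ n k : ℕ, n₀ ≤ n → 2 ≤ k → k ≤ n →
        ∃ (m : ℕ) (W : Fin m → Fin m → ℝ), m ≤ n ∧
          IsCollab W ∧ UnitWeight W ∧
          c₁ * (k : ℝ) ≤ OPT W ∧ OPT W ≤ c₂ * (k : ℝ) ∧
          (∃ θ : Fin m → ℝ, Stable W θ) ∧
          (∀ θ : Fin m → ℝ, Stable W θ → c₃ * (n : ℝ) ≤ ∑ v, θ v) ∧
          ∀ D : Scheme (Fin m), D.Persuasive W →
            c₄ * min ((k : ℝ) * Real.sqrt (n : ℝ)) (n : ℝ) ≤ D.cost := by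
  refine ⟨1 / 4, 2, 1 / 8, 1 / 2400, 1024, by norm_num, by norm_num, by norm_num, by norm_num, ?_⟩
  intro n k hn hk hkn
  set r := Nat.sqrt n with hr
  have hrr : r * r ≤ n := Nat.sqrt_le n
  have hrlt : n < (r + 1) * (r + 1) := Nat.lt_succ_sqrt n
  have hr32 : 32 ≤ r := by
    rw [hr, Nat.le_sqrt]; omega
  set K := min k (r / 4) with hKdef
  set L := n / (2 * K) with hLdef
  set I := k / 4 with hIdef
  have hK2 : 2 ≤ K := by omega
  have hKk : K ≤ k := min_le_left _ _
  have hKr : 4 * K ≤ r := by omega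
  have h16 : 16 * (K * K) ≤ n := by nlinarith
  have hLle : 2 * K * L ≤ n := Nat.mul_div_le _ _
  have hLge : n < 2 * K * (L + 1) := Nat.lt_mul_div_succ _ (by omega)
  have hL : 2 * K ≤ L := by
    rw [hLdef, Nat.le_div_iff_mul_le (by omega)]
    nlinarith
  have hN : n ≤ 4 * (K * L) := by nlinarith
  let e : Fin (K + (K * L + I)) ≃ HubVertex K L I :=
    Fintype.equivOfCardEq (by simp)
  have hcard : K + (K * L + I) ≤ n := by
    have : 4 * K ≤ n := by nlinarith
    have : 2 * (K * L) ≤ n := by linarith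
    omega
  have hself := relabelledWeight_self e
  have hNR : (n : ℝ) ≤ 4 * (K * L) := by exact_mod_cast hN
  have hK2R : (2 : ℝ) ≤ K := by exact_mod_cast hK2
  have hfeas : ∀ θ : Fin (K + (K * L + I)) → ℝ, Feasible (relabelledWeight e) θ →
      (K : ℝ) + I ≤ ∑ v, θ v := by
    intro θ hθ
    rw [← e.symm.sum_comp]
    refine card_le_sum_of_feasible (by omega) (fun a => hθ.1 _) fun a => ?_
    have := hθ.2 (e.symm a)
    rwa [row_relabelled, e.apply_symm_apply] at this
  refine ⟨K + (K * L + I), relabelledWeight e, hcard, ⟨fun u v => hubWeight_symm _ _, ?_, hself⟩,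
    fun u v _ => hubWeight_zero_or_one _ _, ?_, ?_, ?_, ?_, ?_⟩
  · intro u v
    rcases hubWeight_zero_or_one (e u) (e v) with h | h <;> simp [relabelledWeight, h]
  · have hkKI : (k : ℝ) ≤ 4 * (K + I) := by
      have : k ≤ 4 * (K + I) := by omega
      exact_mod_cast this
    refine le_csInf ⟨_, fun _ => 1, ⟨fun _ => zero_le_one, fun v => ?_⟩, rfl⟩ ?_
    · refine (hself v).symm.trans_le ?_
      simp only [mul_one]
      refine Finset.single_le_sum (f := fun u => relabelledWeight e v u) (fun u _ => ?_)
        (Finset.mem_univ v)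
      rcases hubWeight_zero_or_one (e v) (e u) with h | h <;> simp [relabelledWeight, h]
    · rintro c ⟨θ, hθ, rfl⟩
      linarith [hfeas θ hθ]
  · let t : HubVertex K L I → ℝ := Sum.elim (fun _ => 1) (Sum.elim (fun _ => 0) fun _ => 1)
    have ht : ∑ a, t a = K + I := by simp [t]
    have hKI : (K : ℝ) + I ≤ 2 * k := by
      have : K + I ≤ 2 * k := by omega
      exact_mod_cast this
    refine le_trans (b := ∑ v, t (e v)) (csInf_le ⟨(K : ℝ) + I, ?_⟩
      ⟨fun v => t (e v), ⟨fun v => ?_, fun v => ?_⟩, rfl⟩) ?_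
    · rintro c ⟨θ, hθ, rfl⟩
      exact hfeas θ hθ
    · have ht0 : ∀ a, 0 ≤ t a := by rintro (h | q | i) <;> simp [t]
      exact ht0 _
    · rw [row_relabelled]
      simp only [e.apply_symm_apply]
      rcases e v with h | q | i
      · rw [row_hub]
        have : (1 : ℝ) ≤ K := by linarith
        simpa [t] using this
      · rw [row_leaf]
        simp [t]
      · rw [row_isolated]
        simp [t]
    · rw [e.sum_comp t, ht]
      exact hKI
  · obtain ⟨h0, h1, h2⟩ := singleHubSolution_spec (L := L) (I := I) (⟨0, by omega⟩ : Fin K)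
    refine ⟨fun v => singleHubSolution ⟨0, by omega⟩ (e v), (stable_iff hself _).2
      ⟨fun v => h0 _, fun v => ?_, fun v hv => ?_⟩⟩
    · rw [row_relabelled]
      simpa only [e.apply_symm_apply] using h1 (e v)
    · rw [row_relabelled]
      simpa only [e.apply_symm_apply] using h2 (e v) hv
  · intro θ hθ
    obtain ⟨h0, h1, h2⟩ := (stable_iff hself θ).1 hθ
    rw [← e.symm.sum_comp]
    refine le_trans ?_ (le_sum_of_stable (fun a => h0 _) (fun a => ?_) fun a ha => ?_)
    · nlinarith [Nat.cast_nonneg (α := ℝ) L]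
    · have := h1 (e.symm a)
      rwa [row_relabelled, e.apply_symm_apply] at this
    · have := h2 (e.symm a) ha
      rwa [row_relabelled, e.apply_symm_apply] at this
  · intro D hD
    have hn0 : (0 : ℝ) ≤ n := Nat.cast_nonneg n
    have hsq : Real.sqrt n ^ 2 = n := Real.sq_sqrt hn0
    have hcost0 : 0 ≤ D.cost := Finset.sum_nonneg fun s hs =>
      mul_nonneg (D.p_nonneg s hs) (Finset.sum_nonneg fun v _ => (D.sig_mem _ (D.val_mem s hs v)).1)
    rcases hD.cost_lower_bound e hK2 hL with h | h
    · have := min_le_right ((k : ℝ) * Real.sqrt n) n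
      linarith
    · have hKn : K * Real.sqrt n ≤ 32 * D.cost := by
        refine abs_le_of_sq_le_sq' ?_ (by positivity) |>.2
        rw [mul_pow, hsq]
        nlinarith [sq_nonneg (K : ℝ)]
      have hmin : min ((k : ℝ) * Real.sqrt n) n ≤ 8 * (K * Real.sqrt n) := by
        rcases min_choice k (r / 4) with hc | hc
        · refine (min_le_left _ _).trans ?_
          rw [← hKdef] at hc
          rw [hc]
          have : 0 ≤ (k : ℝ) * Real.sqrt n := by positivity
          linarith
        · refine (min_le_right _ _).trans ?_
          have hrK : r + 1 ≤ 8 * K := by omega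
          have hrK' : (r : ℝ) + 1 ≤ 8 * K := by exact_mod_cast hrK
          have hs : Real.sqrt n ≤ r + 1 := by
            rw [Real.sqrt_le_left (by positivity), sq]
            exact_mod_cast hrlt.le
          calc (n : ℝ) = Real.sqrt n * Real.sqrt n := by rw [← sq, hsq]
            _ ≤ 8 * K * Real.sqrt n :=
              mul_le_mul_of_nonneg_right (hs.trans hrK') (Real.sqrt_nonneg _)
            _ = 8 * (K * Real.sqrt n) := by ring
      linarith
end
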